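/- The map ζ⧢ : ℋ⁰_ℤ → ℝ sending 1 to 1 and [s₁,…,s_k] to the convergent multiple zeta series Σ_{n₁>⋯>n_k>0} 1/(n₁^{s₁}⋯n_k^{s_k}) is an algebra homomorphism with respect to the extended shuffle product: ζ⧢(a ⧢ b) = ζ⧢(a)·ζ⧢(b) for all a, b ∈ ℋ⁰_ℤ. -/

import Mathlib

noncomputable section

/-- The vector space ℋ_ℤ with basis the symbols `[s₁,…,s_k]` (lists of integers),
the empty list being the unit `1`. -/
abbrev HZ : Type := List ℤ →₀ ℚ

/-- The basis symbol `[s₁,…,s_k]`. -/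
def bs (l : List ℤ) : HZ := Finsupp.single l 1

/-- Linear extension of a map defined on basis symbols. -/
def hlift (f : List ℤ → HZ) : HZ →ₗ[ℚ] HZ := Finsupp.lift HZ ℚ (List ℤ) f

/-- Prepending a `0` entry to every basis symbol. -/
def preZ : HZ →ₗ[ℚ] HZ := hlift fun l => bs (0 :: l)

/-- The operator `I` adding 1 to the first entry. -/
def Imap : HZ →ₗ[ℚ] HZ := hlift fun l =>
  match l with
  | [] => 0
  | s :: r => bs ((s + 1) :: r)

/-- The operator `J` subtracting 1 from the first entry, with `J(1) = 0`. -/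
def Jmap : HZ →ₗ[ℚ] HZ := hlift fun l =>
  match l with
  | [] => 0
  | s :: r => bs ((s - 1) :: r)

/-- The five-case recursion defining the extended shuffle product on ℋ_ℤ. -/
def IsExtShuffle (m : HZ →ₗ[ℚ] HZ →ₗ[ℚ] HZ) : Prop :=
  (∀ x, m (bs []) x = x) ∧
  (∀ x, m x (bs []) = x) ∧
  (∀ (s' : List ℤ) (t₁ : ℤ) (t' : List ℤ),
    m (bs (0 :: s')) (bs (t₁ :: t')) = preZ (m (bs s') (bs (t₁ :: t')))) ∧
  (∀ (s₁ : ℤ), 0 < s₁ → ∀ (s' t' : List ℤ),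
    m (bs (s₁ :: s')) (bs (0 :: t')) = preZ (m (bs (s₁ :: s')) (bs t'))) ∧
  (∀ (s₁ t₁ : ℤ), 0 < s₁ → 0 < t₁ → ∀ (s' t' : List ℤ),
    m (bs (s₁ :: s')) (bs (t₁ :: t')) =
      Imap (m (bs (s₁ :: s')) (bs ((t₁ - 1) :: t'))) +
      Imap (m (bs ((s₁ - 1) :: s')) (bs (t₁ :: t')))) ∧
  (∀ (s₁ t₁ : ℤ), 0 < s₁ → t₁ < 0 → ∀ (s' t' : List ℤ),
    m (bs (s₁ :: s')) (bs (t₁ :: t')) =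
      Jmap (m (bs (s₁ :: s')) (bs ((t₁ + 1) :: t'))) -
      m (bs ((s₁ - 1) :: s')) (bs ((t₁ + 1) :: t'))) ∧
  (∀ (s₁ : ℤ), s₁ < 0 → ∀ (t₁ : ℤ) (s' t' : List ℤ),
    m (bs (s₁ :: s')) (bs (t₁ :: t')) =
      Jmap (m (bs ((s₁ + 1) :: s')) (bs (t₁ :: t'))) -
      m (bs ((s₁ + 1) :: s')) (bs ((t₁ - 1) :: t')))

/-- The subspace of ℋ_ℤ spanned by `1` and the symbols `[s₁,…,s_k]` with `s₁+⋯+s_j > j` for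
all `j = 1,…,k` (the convergent integer points). -/
def Hconv : Submodule ℚ HZ :=
  Submodule.span ℚ
    {x : HZ | ∃ l : List ℤ,
      (∀ j : ℕ, 1 ≤ j → j ≤ l.length → (j : ℤ) < (l.take j).sum) ∧ x = bs l}

/-- The multiple zeta series of a symbol `[s₁,…,s_k]`. -/
def zetaS (l : List ℤ) : ℝ :=
  ∑' n : {n : Fin l.length → ℕ //
      (∀ i, 0 < n i) ∧ ∀ i j : Fin l.length, i < j → n j < n i},
    ∏ i, ((n.1 i : ℝ) ^ (l.get i))⁻¹

/-- The linear map `ζ⧢` sending a symbol to its multiple zeta series. -/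
def zetaMap : HZ →ₗ[ℚ] ℝ := Finsupp.lift ℝ ℚ (List ℤ) zetaS

/-- Coefficients of the polylogarithm attached to a symbol. -/
def cf : List ℤ → ℕ → ℝ
  | [], n => if n = 0 then 1 else 0
  | (a :: r), n => (n : ℝ) ^ (-a) * ∑ k ∈ Finset.range n, cf r k

theorem cf_nonneg (l : List ℤ) : ∀ n, 0 ≤ cf l n := by
  induction l with
  | nil => intro n; simp only [cf]; split_ifs <;> norm_num
  | cons a r ih =>
    intro n
    simp only [cf]
    exact mul_nonneg (by positivity) (Finset.sum_nonneg fun i _ => ih i)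

/-- All defects `j - (s₁+⋯+s_j)`, `j ≥ 1`, are at most `e`. -/
def Ble : ℤ → List ℤ → Prop
  | _, [] => True
  | e, (a :: r) => 1 - a ≤ e ∧ Ble (e - 1 + a) r

theorem Ble.mono {l : List ℤ} : ∀ {e f : ℤ}, Ble e l → e ≤ f → Ble f l := by
  induction l with
  | nil => intros; trivial
  | cons a r ih =>
    intro e f h hef
    exact ⟨h.1.trans hef, ih h.2 (by omega)⟩

theorem Ble_of_take (l : List ℤ) : ∀ e : ℤ,
    (∀ j : ℕ, 1 ≤ j → j ≤ l.length → (j : ℤ) - (l.take j).sum ≤ e) → Ble e l := by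
  induction l with
  | nil => intros; trivial
  | cons a r ih =>
    intro e h
    refine ⟨by simpa using h 1 le_rfl (by simp), ih _ fun j h1 h2 => ?_⟩
    have := h (j + 1) (by omega) (by simpa using h2)
    simp only [List.take_succ_cons, List.sum_cons] at this
    push_cast at this
    omega

/-- Filtration of `HZ` by the defect bound. -/
def V (e : ℤ) : Submodule ℚ HZ := Submodule.span ℚ {x | ∃ l, Ble e l ∧ x = bs l}

theorem V_mono {e f : ℤ} (h : e ≤ f) : V e ≤ V f := by
  apply Submodule.span_mono
  rintro x ⟨l, hl, rfl⟩
  exact ⟨l, hl.mono h, rfl⟩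

theorem bs_mem_V {e : ℤ} {l : List ℤ} (h : Ble e l) : bs l ∈ V e :=
  Submodule.subset_span ⟨l, h, rfl⟩

theorem hlift_bs (f : List ℤ → HZ) (l : List ℤ) : hlift f (bs l) = f l := by
  simp [hlift, bs]

theorem map_V {e f : ℤ} (T : HZ →ₗ[ℚ] HZ) (hT : ∀ l, Ble e l → T (bs l) ∈ V f) {x : HZ}
    (hx : x ∈ V e) : T x ∈ V f := by
  have : V e ≤ (V f).comap T := by
    apply Submodule.span_le.2
    rintro x ⟨l, hl, rfl⟩
    exact hT l hl
  exact this hx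

theorem Imap_V {e : ℤ} {x : HZ} (hx : x ∈ V e) : Imap x ∈ V (e - 1) := by
  refine map_V _ (fun l hl => ?_) hx
  rw [Imap, hlift_bs]
  cases l with
  | nil => exact Submodule.zero_mem _
  | cons a r => exact bs_mem_V ⟨by have := hl.1; omega, hl.2.mono (by omega)⟩

theorem Jmap_V {e : ℤ} {x : HZ} (hx : x ∈ V e) : Jmap x ∈ V (e + 1) := by
  refine map_V _ (fun l hl => ?_) hx
  rw [Jmap, hlift_bs]
  cases l with
  | nil => exact Submodule.zero_mem _
  | cons a r => exact bs_mem_V ⟨by have := hl.1; omega, hl.2.mono (by omega)⟩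

theorem preZ_V {e : ℤ} {x : HZ} (hx : x ∈ V e) : preZ x ∈ V (1 + max 0 e) := by
  refine map_V _ (fun l hl => ?_) hx
  rw [preZ, hlift_bs]
  exact bs_mem_V ⟨by omega, hl.mono (by omega)⟩

/-- The induction principle matching the recursion of the extended shuffle product. -/
theorem pair_ind {P : List ℤ → List ℤ → Prop}
    (h1 : ∀ t, P [] t) (h2 : ∀ s, P s [])
    (h3 : ∀ s' t₁ t', P s' (t₁ :: t') → P (0 :: s') (t₁ :: t'))
    (h4 : ∀ s₁ s' t', 0 < s₁ → P (s₁ :: s') t' → P (s₁ :: s') (0 :: t'))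
    (h5 : ∀ s₁ t₁ s' t', 0 < s₁ → 0 < t₁ → P (s₁ :: s') ((t₁ - 1) :: t') →
      P ((s₁ - 1) :: s') (t₁ :: t') → P (s₁ :: s') (t₁ :: t'))
    (h6 : ∀ s₁ t₁ s' t', 0 < s₁ → t₁ < 0 → P (s₁ :: s') ((t₁ + 1) :: t') →
      P ((s₁ - 1) :: s') ((t₁ + 1) :: t') → P (s₁ :: s') (t₁ :: t'))
    (h7 : ∀ s₁ t₁ s' t', s₁ < 0 → P ((s₁ + 1) :: s') (t₁ :: t') →
      P ((s₁ + 1) :: s') ((t₁ - 1) :: t') → P (s₁ :: s') (t₁ :: t')) :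
    ∀ s t, P s t := by
  have key : ∀ N : ℕ, ∀ s t : List ℤ, s.length + t.length = N → P s t := by
    intro N
    induction N using Nat.strong_induction_on with
    | _ N ihN =>
    -- nonnegative first entry
    have pos : ∀ M : ℕ, ∀ (s₁ t₁ : ℤ) (s' t' : List ℤ), 0 ≤ s₁ → s₁.natAbs + t₁.natAbs = M →
        (s₁ :: s').length + (t₁ :: t').length = N → P (s₁ :: s') (t₁ :: t') := by
      intro M
      induction M using Nat.strong_induction_on with
      | _ M ihM =>
      intro s₁ t₁ s' t' hs hM hN
      simp only [List.length_cons] at hN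
      rcases hs.eq_or_lt with rfl | hs
      · exact h3 _ _ _ (ihN _ (by simp only [List.length_cons]; omega) _ _ rfl)
      rcases lt_trichotomy t₁ 0 with ht | rfl | ht
      · exact h6 _ _ _ _ hs ht
          (ihM _ (by omega) _ _ _ _ (by omega) rfl (by simp only [List.length_cons]; omega))
          (ihM _ (by omega) _ _ _ _ (by omega) rfl (by simp only [List.length_cons]; omega))
      · exact h4 _ _ _ hs (ihN _ (by simp only [List.length_cons]; omega) _ _ rfl)
      · exact h5 _ _ _ _ hs ht
          (ihM _ (by omega) _ _ _ _ (by omega) rfl (by simp only [List.length_cons]; omega))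
          (ihM _ (by omega) _ _ _ _ (by omega) rfl (by simp only [List.length_cons]; omega))
    have all : ∀ M : ℕ, ∀ (s₁ t₁ : ℤ) (s' t' : List ℤ), (-s₁).toNat = M →
        (s₁ :: s').length + (t₁ :: t').length = N → P (s₁ :: s') (t₁ :: t') := by
      intro M
      induction M with
      | zero => intro s₁ t₁ s' t' h hN; exact pos _ _ _ _ _ (by omega) rfl hN
      | succ M ih =>
        intro s₁ t₁ s' t' h hN
        exact h7 _ _ _ _ (by omega) (ih _ _ _ _ (by omega) hN) (ih _ _ _ _ (by omega) hN)
    intro s t hN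
    cases s with
    | nil => exact h1 t
    | cons s₁ s' =>
      cases t with
      | nil => exact h2 _
      | cons t₁ t' => exact all _ _ _ _ _ rfl hN
  exact fun s t => key _ s t rfl

theorem shuffle_V (m : HZ →ₗ[ℚ] HZ →ₗ[ℚ] HZ) (hm : IsExtShuffle m) :
    ∀ s t : List ℤ, ∀ e f : ℤ, Ble e s → Ble f t →
      m (bs s) (bs t) ∈ V (max (max e f) (e + f)) := by
  obtain ⟨m1, m2, m3, m4, m5, m6, m7⟩ := hm
  apply pair_ind
  · intro t e f he hf
    rw [m1]
    exact bs_mem_V (hf.mono (by omega))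
  · intro s e f he hf
    rw [m2]
    exact bs_mem_V (he.mono (by omega))
  · intro s' t₁ t' ih e f he hf
    rw [m3]
    have h1 := he.1
    exact V_mono (by omega) (preZ_V (ih (e - 1) f (he.2.mono (by omega)) hf))
  · intro s₁ s' t' hs ih e f he hf
    rw [m4 _ hs]
    have h1 := hf.1
    exact V_mono (by omega) (preZ_V (ih e (f - 1) he (hf.2.mono (by omega))))
  · intro s₁ t₁ s' t' hs ht ih1 ih2 e f he hf
    rw [m5 _ _ hs ht]
    have h1 := he.1
    have h2 := hf.1
    refine Submodule.add_mem _ ?_ ?_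
    · exact V_mono (by omega)
        (Imap_V (ih1 e (f + 1) he ⟨by omega, hf.2.mono (by omega)⟩))
    · exact V_mono (by omega)
        (Imap_V (ih2 (e + 1) f ⟨by omega, he.2.mono (by omega)⟩ hf))
  · intro s₁ t₁ s' t' hs ht ih1 ih2 e f he hf
    rw [m6 _ _ hs ht]
    have h1 := he.1
    have h2 := hf.1
    refine Submodule.sub_mem _ ?_ ?_
    · exact V_mono (by omega)
        (Jmap_V (ih1 e (f - 1) he ⟨by omega, hf.2.mono (by omega)⟩))
    · exact V_mono (by omega)
        (ih2 (e + 1) (f - 1) ⟨by omega, he.2.mono (by omega)⟩ ⟨by omega, hf.2.mono (by omega)⟩)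
  · intro s₁ t₁ s' t' hs ih1 ih2 e f he hf
    rw [m7 _ hs]
    have h1 := he.1
    have h2 := hf.1
    refine Submodule.sub_mem _ ?_ ?_
    · exact V_mono (by omega)
        (Jmap_V (ih1 (e - 1) f ⟨by omega, he.2.mono (by omega)⟩ hf))
    · exact V_mono (by omega)
        (ih2 (e - 1) (f + 1) ⟨by omega, he.2.mono (by omega)⟩ ⟨by omega, hf.2.mono (by omega)⟩)

/-- The polylogarithm of a symbol, as a formal power series. -/
def LiS (l : List ℤ) : PowerSeries ℝ := PowerSeries.mk (cf l)

/-- Linear extension of `LiS`. -/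
def LiM : HZ →ₗ[ℚ] PowerSeries ℝ := Finsupp.lift (PowerSeries ℝ) ℚ (List ℤ) LiS

theorem LiM_bs (l : List ℤ) : LiM (bs l) = LiS l := by
  simp [LiM, bs]

/-- The Euler operator. -/
def theta : PowerSeries ℝ →ₗ[ℝ] PowerSeries ℝ where
  toFun f := PowerSeries.X * PowerSeries.derivative ℝ f
  map_add' f g := by rw [map_add, mul_add]
  map_smul' c f := by simp

theorem theta_mul (f g : PowerSeries ℝ) : theta (f * g) = theta f * g + f * theta g := by
  simp only [theta, LinearMap.coe_mk, AddHom.coe_mk, Derivation.leibniz, smul_eq_mul]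
  ring

theorem coeff_theta (f : PowerSeries ℝ) (n : ℕ) :
    PowerSeries.coeff n (theta f) = n * PowerSeries.coeff n f := by
  cases n with
  | zero => simp [theta]
  | succ n =>
    simp only [theta, LinearMap.coe_mk, AddHom.coe_mk, PowerSeries.coeff_succ_X_mul,
      PowerSeries.coeff_derivative]
    push_cast
    ring

theorem theta_inj {f g : PowerSeries ℝ} (h : theta f = theta g)
    (h0 : PowerSeries.coeff 0 f = PowerSeries.coeff 0 g) : f = g := by
  ext n
  cases n with
  | zero => exact h0
  | succ n =>
    have := congrArg (PowerSeries.coeff (n + 1)) h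
    rw [coeff_theta, coeff_theta] at this
    exact mul_left_cancel₀ (by positivity) this

theorem hz_ext {M : Type*} [AddCommGroup M] [Module ℚ M] {T U : HZ →ₗ[ℚ] M}
    (h : ∀ l, T (bs l) = U (bs l)) : T = U := by
  apply Finsupp.lhom_ext'
  intro l
  ext
  simpa [bs] using h l

theorem LiS_cons_zero (a : ℤ) (r : List ℤ) : PowerSeries.coeff 0 (LiS (a :: r)) = 0 := by
  simp [LiS, cf]

theorem theta_LiS (a : ℤ) (r : List ℤ) : theta (LiS (a :: r)) = LiS ((a - 1) :: r) := by
  ext n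
  rw [coeff_theta]
  simp only [LiS, PowerSeries.coeff_mk, cf]
  rcases Nat.eq_zero_or_pos n with rfl | hn
  · simp
  · have : (n : ℝ) ≠ 0 := by positivity
    rw [show -(a - 1) = 1 + -a by ring, zpow_add₀ this, zpow_one]
    ring

theorem LiS_zero (r : List ℤ) :
    LiS (0 :: r) * (1 - PowerSeries.X) = PowerSeries.X * LiS r := by
  ext n
  rw [mul_sub, mul_one, map_sub]
  cases n with
  | zero => simp [LiS, cf]
  | succ n =>
    rw [PowerSeries.coeff_succ_mul_X, PowerSeries.coeff_succ_X_mul]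
    simp [LiS, cf, Finset.sum_range_succ]

theorem LiM_Jmap (x : HZ) : LiM (Jmap x) = theta (LiM x) := by
  have : LiM ∘ₗ Jmap = (theta.restrictScalars ℚ) ∘ₗ LiM := by
    apply hz_ext
    intro l
    simp only [LinearMap.comp_apply, LinearMap.restrictScalars_apply, LiM_bs]
    rw [Jmap, hlift_bs]
    cases l with
    | nil =>
      ext n
      rw [coeff_theta]
      rcases Nat.eq_zero_or_pos n with rfl | hn
      · simp
      · simp [LiS, cf, hn.ne']
    | cons a r => simp only [LiM_bs, theta_LiS]
  exact LinearMap.congr_fun this x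

theorem LiM_Imap_zero (x : HZ) : PowerSeries.coeff 0 (LiM (Imap x)) = 0 := by
  have : ((PowerSeries.coeff (R := ℝ) 0).restrictScalars ℚ) ∘ₗ LiM ∘ₗ Imap = 0 := by
    apply hz_ext
    intro l
    simp only [LinearMap.comp_apply, LinearMap.restrictScalars_apply]
    rw [Imap, hlift_bs]
    cases l with
    | nil => simp
    | cons a r => simp only [LiM_bs, LiS_cons_zero]; rfl
  exact LinearMap.congr_fun this x

theorem theta_LiM_Imap (x : HZ) (hx : PowerSeries.coeff 0 (LiM x) = 0) :
    theta (LiM (Imap x)) = LiM x := by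
  have : ∀ n : ℕ, ((PowerSeries.coeff (R := ℝ) (n + 1)).restrictScalars ℚ) ∘ₗ
      (theta.restrictScalars ℚ) ∘ₗ LiM ∘ₗ Imap =
      ((PowerSeries.coeff (R := ℝ) (n + 1)).restrictScalars ℚ) ∘ₗ LiM := by
    intro n
    apply hz_ext
    intro l
    simp only [LinearMap.comp_apply, LinearMap.restrictScalars_apply]
    rw [Imap, hlift_bs]
    cases l with
    | nil => simp [LiM_bs, LiS, cf]
    | cons a r => simp only [LiM_bs, theta_LiS, add_sub_cancel_right]
  ext n
  cases n with
  | zero => rw [coeff_theta, hx]; simp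
  | succ n => exact LinearMap.congr_fun (this n) x

theorem LiM_preZ (x : HZ) : LiM (preZ x) * (1 - PowerSeries.X) = PowerSeries.X * LiM x := by
  have : (LinearMap.mulRight ℚ (1 - PowerSeries.X : PowerSeries ℝ)) ∘ₗ LiM ∘ₗ preZ =
      (LinearMap.mulLeft ℚ (PowerSeries.X : PowerSeries ℝ)) ∘ₗ LiM := by
    apply hz_ext
    intro l
    simp only [LinearMap.comp_apply, LinearMap.mulRight_apply, LinearMap.mulLeft_apply]
    rw [preZ, hlift_bs, LiM_bs, LiM_bs, LiS_zero]
  exact LinearMap.congr_fun this x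

theorem one_sub_X_ne : (1 - PowerSeries.X : PowerSeries ℝ) ≠ 0 := by
  intro h
  have := congrArg (PowerSeries.coeff 0) h
  simp at this

theorem LiS_nil : LiS [] = 1 := by
  ext n
  simp [LiS, cf, PowerSeries.coeff_one]

theorem LiM_shuffle (m : HZ →ₗ[ℚ] HZ →ₗ[ℚ] HZ) (hm : IsExtShuffle m) :
    ∀ s t : List ℤ, LiM (m (bs s) (bs t)) = LiS s * LiS t := by
  obtain ⟨m1, m2, m3, m4, m5, m6, m7⟩ := hm
  apply pair_ind
  · intro t
    rw [m1, LiM_bs, LiS_nil, one_mul]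
  · intro s
    rw [m2, LiM_bs, LiS_nil, mul_one]
  · intro s' t₁ t' ih
    rw [m3]
    apply mul_right_cancel₀ one_sub_X_ne
    rw [LiM_preZ, ih, mul_right_comm, LiS_zero, mul_assoc]
  · intro s₁ s' t' hs ih
    rw [m4 _ hs]
    apply mul_right_cancel₀ one_sub_X_ne
    rw [LiM_preZ, ih, mul_assoc, LiS_zero]
    ring
  · intro s₁ t₁ s' t' hs ht ih1 ih2
    rw [m5 _ _ hs ht]
    have c0 : ∀ (a : ℤ) (r : List ℤ) (g : PowerSeries ℝ),
        PowerSeries.coeff 0 (LiS (a :: r) * g) = 0 := by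
      intro a r g
      have := LiS_cons_zero a r
      rw [PowerSeries.coeff_zero_eq_constantCoeff_apply] at this ⊢
      rw [map_mul, this, zero_mul]
    apply theta_inj
    · rw [map_add, map_add, theta_LiM_Imap _ (by rw [ih1, c0]),
        theta_LiM_Imap _ (by rw [ih2, c0]), ih1, ih2, theta_mul, theta_LiS, theta_LiS, add_comm]
    · rw [map_add, map_add, LiM_Imap_zero, LiM_Imap_zero, c0, add_zero]
  · intro s₁ t₁ s' t' hs ht ih1 ih2
    rw [m6 _ _ hs ht, map_sub, LiM_Jmap, ih1, ih2, theta_mul, theta_LiS, theta_LiS,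
      add_sub_cancel_right]
    ring
  · intro s₁ t₁ s' t' hs ih1 ih2
    rw [m7 _ hs, map_sub, LiM_Jmap, ih1, ih2, theta_mul, theta_LiS, theta_LiS,
      add_sub_cancel_right, add_sub_cancel_right]

theorem sum_inv_sqrt' (n : ℕ) :
    ∑ k ∈ Finset.range (n + 1), (√((k : ℝ)))⁻¹ ≤ 2 * √(n : ℝ) := by
  induction n with
  | zero => simp
  | succ n ih =>
    rw [Finset.sum_range_succ]
    have hx : 0 < √((n + 1 : ℕ) : ℝ) := Real.sqrt_pos.2 (by positivity)
    have hx2 : √((n + 1 : ℕ) : ℝ) ^ 2 = n + 1 := by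
      rw [Real.sq_sqrt (by positivity)]; push_cast; ring
    have hy2 : √(n : ℝ) ^ 2 = n := Real.sq_sqrt (by positivity)
    have key : (√((n + 1 : ℕ) : ℝ))⁻¹ ≤ 2 * √((n + 1 : ℕ) : ℝ) - 2 * √(n : ℝ) := by
      rw [inv_le_iff_one_le_mul₀ hx]
      nlinarith [sq_nonneg (√((n + 1 : ℕ) : ℝ) - √(n : ℝ))]
    linarith

theorem sum_inv_sqrt (n : ℕ) :
    ∑ k ∈ Finset.range n, (√((k : ℝ)))⁻¹ ≤ 2 * √(n : ℝ) := by
  refine le_trans ?_ (sum_inv_sqrt' n)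
  rw [Finset.sum_range_succ]
  exact le_add_of_nonneg_right (by positivity)

theorem cf_bound (l : List ℤ) : ∀ e : ℤ, Ble e l →
    ∃ C : ℝ, 0 ≤ C ∧ ∀ n : ℕ, 1 ≤ n → cf l n ≤ C * ((n : ℝ) ^ e / √(n : ℝ)) := by
  induction l with
  | nil =>
    intro e _
    refine ⟨0, le_rfl, fun n hn => ?_⟩
    have : n ≠ 0 := by omega
    simp [cf, this]
  | cons a r ih =>
    intro e he
    obtain ⟨C, hC, h⟩ := ih _ he.2
    obtain ⟨f, hf⟩ := Int.eq_ofNat_of_zero_le (show 0 ≤ e - 1 + a by have := he.1; omega)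
    refine ⟨1 + 2 * C, by positivity, fun n hn => ?_⟩
    have h0 : (0 : ℝ) < n := by exact_mod_cast hn
    have h1 : (1 : ℝ) ≤ n := by exact_mod_cast hn
    have hs1 : 1 ≤ √(n : ℝ) := Real.one_le_sqrt.2 h1
    have hc0 : cf r 0 ≤ 1 := by
      cases r <;> simp [cf]
    have hsum : ∑ k ∈ Finset.range n, cf r k ≤ (1 + 2 * C) * ((n : ℝ) ^ f * √(n : ℝ)) := by
      have hterm : ∀ k ∈ Finset.range n,
          cf r k ≤ (if k = 0 then 1 else 0) + C * (n : ℝ) ^ f * (√(k : ℝ))⁻¹ := by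
        intro k hk
        rcases Nat.eq_zero_or_pos k with rfl | hk0
        · simpa using hc0
        · have hkn : (k : ℝ) ≤ n := by exact_mod_cast (Finset.mem_range.1 hk).le
          have hk0' : k ≠ 0 := by omega
          have := h k hk0
          rw [hf] at this
          simp only [zpow_natCast] at this
          rw [if_neg hk0', zero_add]
          refine this.trans ?_
          rw [div_eq_mul_inv, ← mul_assoc]
          gcongr
      refine (Finset.sum_le_sum hterm).trans ?_
      rw [Finset.sum_add_distrib, ← Finset.mul_sum]
      have e1 : ∑ k ∈ Finset.range n, (if k = 0 then (1 : ℝ) else 0) ≤ 1 := by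
        rw [Finset.sum_ite_eq']; split_ifs <;> norm_num
      have e2 := mul_le_mul_of_nonneg_left (sum_inv_sqrt n)
        (show 0 ≤ C * (n : ℝ) ^ f by positivity)
      have e3 : 1 ≤ (n : ℝ) ^ f * √(n : ℝ) := one_le_mul_of_one_le_of_one_le (one_le_pow₀ h1) hs1
      nlinarith
    have hsq : √(n : ℝ) * √(n : ℝ) = n := Real.mul_self_sqrt h0.le
    calc cf (a :: r) n ≤ (n : ℝ) ^ (-a) * ((1 + 2 * C) * ((n : ℝ) ^ f * √(n : ℝ))) := by
          simp only [cf]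
          gcongr
      _ = (1 + 2 * C) * ((n : ℝ) ^ e / √(n : ℝ)) := by
          have : (n : ℝ) ^ e = (n : ℝ) ^ (-a) * (n : ℝ) ^ f * n := by
            rw [show e = -a + f + 1 by have : e - 1 + a = f := hf; omega,
              zpow_add₀ h0.ne', zpow_add₀ h0.ne', zpow_one, zpow_natCast]
          rw [this]
          field_simp
          rw [Real.sq_sqrt h0.le]

theorem cf_summable (l : List ℤ) (h : Ble (-1) l) : Summable (cf l) := by
  obtain ⟨C, hC, hb⟩ := cf_bound l _ h
  rw [← summable_nat_add_iff 1]
  have hs : Summable fun n : ℕ => C * ((n + 1 : ℕ) : ℝ) ^ (-(3 / 2 : ℝ)) := by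
    apply Summable.mul_left
    exact (summable_nat_add_iff 1).2 (Real.summable_nat_rpow.2 (by norm_num))
  refine Summable.of_nonneg_of_le (fun n => cf_nonneg l _) (fun n => ?_) hs
  refine (hb (n + 1) (by omega)).trans (le_of_eq ?_)
  have h0 : (0 : ℝ) < ((n + 1 : ℕ) : ℝ) := by positivity
  congr 1
  rw [Real.sqrt_eq_rpow, ← Real.rpow_intCast, ← Real.rpow_sub h0]
  norm_num

/-- The largest index (0 for the empty tuple). -/
def hd : (k : ℕ) → (Fin k → ℕ) → ℕ
  | 0, _ => 0
  | _ + 1, n => n 0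

/-- Strictly decreasing positive tuples. -/
def Dec (k : ℕ) (n : Fin k → ℕ) : Prop :=
  (∀ i, 0 < n i) ∧ ∀ i j : Fin k, i < j → n j < n i

theorem Dec_cons (k : ℕ) (a : ℕ) (n : Fin k → ℕ) :
    Dec (k + 1) (Fin.cons a n) ↔ hd k n < a ∧ Dec k n := by
  constructor
  · rintro ⟨h1, h2⟩
    refine ⟨?_, fun i => by simpa using h1 i.succ, fun i j hij => by
      simpa using h2 i.succ j.succ (by simpa using hij)⟩
    cases k with
    | zero => simpa [hd] using h1 0
    | succ k => simpa [hd] using h2 0 (Fin.succ 0) (Fin.succ_pos _)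
  · rintro ⟨h1, h2, h3⟩
    have hle : ∀ i, n i < a := by
      intro i
      cases k with
      | zero => exact i.elim0
      | succ k =>
        rcases Fin.eq_zero_or_eq_succ i with rfl | ⟨j, rfl⟩
        · exact h1
        · exact (h3 0 j.succ (Fin.succ_pos _)).trans h1
    refine ⟨fun i => ?_, fun i j hij => ?_⟩
    · refine Fin.cases ?_ (fun i => ?_) i
      · simpa using lt_of_le_of_lt (Nat.zero_le _) h1
      · simpa using h2 i
    · induction j using Fin.cases with
      | zero => exact absurd hij (Fin.not_lt_zero i)
      | succ j =>
        induction i using Fin.cases with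
        | zero => simpa using hle j
        | succ i => simpa using h3 i j (by simpa using hij)

open Classical in
theorem tuple_sum (l : List ℤ) : ∀ g : ℕ → ENNReal,
    ∑' n : Fin l.length → ℕ, (if Dec l.length n then
      ENNReal.ofReal (∏ i, ((n i : ℝ) ^ (l.get i))⁻¹) * g (hd l.length n) else 0) =
    ∑' n : ℕ, ENNReal.ofReal (cf l n) * g n := by
  induction l with
  | nil =>
    intro g
    have hD : ∀ n : Fin 0 → ℕ, Dec 0 n := fun n => ⟨fun i => i.elim0, fun i => i.elim0⟩
    rw [tsum_eq_single (0 : ℕ) (by intro b hb; simp [cf, hb])]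
    change ∑' n : Fin 0 → ℕ, _ = _
    rw [tsum_eq_single (default : Fin 0 → ℕ) (by intro b hb; exact absurd (Subsingleton.elim _ _) hb)]
    refine (if_pos (hD _)).trans ?_
    simp [cf, hd]
  | cons a r ih =>
    intro g
    change ∑' n : Fin (r.length + 1) → ℕ, (if Dec (r.length + 1) n then
      ENNReal.ofReal (∏ i : Fin (r.length + 1), ((n i : ℝ) ^ ((a :: r).get i))⁻¹) *
        g (hd (r.length + 1) n) else 0) = _
    rw [← (Fin.consEquiv (fun _ : Fin (r.length + 1) => ℕ)).tsum_eq]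
    rw [ENNReal.tsum_prod', ENNReal.tsum_comm]
    have step : ∀ (t : Fin r.length → ℕ) (n : ℕ),
        (if Dec (r.length + 1) (Fin.consEquiv (fun _ : Fin (r.length + 1) => ℕ) (n, t)) then
          ENNReal.ofReal (∏ i : Fin (r.length + 1),
            ((Fin.consEquiv (fun _ : Fin (r.length + 1) => ℕ) (n, t) i : ℝ) ^
              ((a :: r).get i))⁻¹) *
            g (hd (r.length + 1) (Fin.consEquiv (fun _ : Fin (r.length + 1) => ℕ) (n, t)))
          else 0) =
        (if Dec r.length t then
          ENNReal.ofReal (∏ i, ((t i : ℝ) ^ (r.get i))⁻¹) *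
            (if hd r.length t < n then ENNReal.ofReal ((n : ℝ) ^ (-a)) * g n else 0) else 0) := by
      intro t n
      have hE : Fin.consEquiv (fun _ : Fin (r.length + 1) => ℕ) (n, t) = Fin.cons n t := rfl
      rw [hE]
      by_cases hD : Dec r.length t
      · by_cases hn : hd r.length t < n
        · rw [if_pos ((Dec_cons _ _ _).2 ⟨hn, hD⟩), if_pos hD, if_pos hn, Fin.prod_univ_succ]
          simp only [Fin.cons_zero, Fin.cons_succ, List.get_cons_zero, List.get_cons_succ', hd]
          rw [ENNReal.ofReal_mul (by positivity), zpow_neg]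
          ring
        · rw [if_neg (fun h => hn ((Dec_cons _ _ _).1 h).1), if_pos hD, if_neg hn, mul_zero]
      · rw [if_neg (fun h => hD ((Dec_cons _ _ _).1 h).2), if_neg hD]
    simp only [step]
    have pull : ∀ t : Fin r.length → ℕ, (∑' n : ℕ, if Dec r.length t then
          ENNReal.ofReal (∏ i, ((t i : ℝ) ^ (r.get i))⁻¹) *
            (if hd r.length t < n then ENNReal.ofReal ((n : ℝ) ^ (-a)) * g n else 0) else 0) =
        if Dec r.length t then ENNReal.ofReal (∏ i, ((t i : ℝ) ^ (r.get i))⁻¹) *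
          (fun k => ∑' n : ℕ, if k < n then ENNReal.ofReal ((n : ℝ) ^ (-a)) * g n else 0)
            (hd r.length t) else 0 := by
      intro t
      split_ifs
      · rw [ENNReal.tsum_mul_left]
      · simp
    refine (tsum_congr pull).trans ((ih (fun k => ∑' n : ℕ,
      if k < n then ENNReal.ofReal ((n : ℝ) ^ (-a)) * g n else 0)).trans ?_)
    simp only [← ENNReal.tsum_mul_left]
    rw [ENNReal.tsum_comm]
    congr 1
    ext n
    rw [tsum_eq_sum (s := Finset.range n) (by
      intro k hk
      rw [if_neg (by simpa using hk), mul_zero])]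
    simp only [cf]
    rw [ENNReal.ofReal_mul (by positivity), ENNReal.ofReal_sum_of_nonneg
      (fun i _ => cf_nonneg r i), Finset.mul_sum, Finset.sum_mul]
    refine Finset.sum_congr rfl fun k hk => ?_
    rw [if_pos (by simpa using hk)]
    ring

theorem zetaS_eq (l : List ℤ) : zetaS l = ∑' n, cf l n := by
  classical
  have h := tuple_sum l (fun _ => 1)
  simp only [mul_one] at h
  have h2 : ∑' n : ℕ, cf l n = (∑' n : ℕ, ENNReal.ofReal (cf l n)).toReal := by
    rw [ENNReal.tsum_toReal_eq (fun _ => ENNReal.ofReal_ne_top)]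
    exact tsum_congr fun n => (ENNReal.toReal_ofReal (cf_nonneg l n)).symm
  rw [h2, ← h, ENNReal.tsum_toReal_eq (fun n => by split_ifs <;> simp)]
  refine (tsum_subtype {n : Fin l.length → ℕ | Dec l.length n}
    (fun n => ∏ i, ((n i : ℝ) ^ (l.get i))⁻¹)).trans ?_
  refine tsum_congr fun n => ?_
  by_cases hn : Dec l.length n
  · have hmem : n ∈ {n : Fin l.length → ℕ | Dec l.length n} := hn
    have hpos : 0 ≤ ∏ i, ((n i : ℝ) ^ (l.get i))⁻¹ :=
      Finset.prod_nonneg fun i _ => by positivity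
    rw [if_pos hn, Set.indicator_of_mem hmem, ENNReal.toReal_ofReal hpos]
  · have hmem : n ∉ {n : Fin l.length → ℕ | Dec l.length n} := hn
    rw [if_neg hn, Set.indicator_of_notMem hmem, ENNReal.toReal_zero]

theorem zetaMap_bs (l : List ℤ) : zetaMap (bs l) = zetaS l := by
  simp [zetaMap, bs]

theorem hasSum_zeta {x : HZ} (hx : x ∈ V (-1)) :
    HasSum (fun n => PowerSeries.coeff n (LiM x)) (zetaMap x) := by
  induction hx using Submodule.span_induction with
  | mem x h =>
    obtain ⟨l, hl, rfl⟩ := h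
    rw [zetaMap_bs, zetaS_eq, LiM_bs]
    simpa [LiS] using (cf_summable l hl).hasSum
  | zero => simp
  | add x y _ _ h1 h2 => simpa using h1.add h2
  | smul c x _ h =>
    rw [map_smul, map_smul]
    exact h.const_smul c

/-- `ζ⧢ : ℋ⁰_ℤ → ℝ` sends `1` to `1` and is an algebra homomorphism for the extended shuffle
product. -/
theorem zeta_algebra_hom (m : HZ →ₗ[ℚ] HZ →ₗ[ℚ] HZ) (hm : IsExtShuffle m) :
    zetaMap (bs []) = 1 ∧
    ∀ a ∈ Hconv, ∀ b ∈ Hconv, zetaMap (m a b) = zetaMap a * zetaMap b := by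
  refine ⟨?_, ?_⟩
  · rw [zetaMap_bs, zetaS_eq, tsum_eq_single 0 (by intro n hn; simp [cf, hn])]
    simp [cf]
  have hV : ∀ l : List ℤ, (∀ j : ℕ, 1 ≤ j → j ≤ l.length → (j : ℤ) < (l.take j).sum) →
      Ble (-1) l := fun l h => Ble_of_take l _ fun j h1 h2 => by have := h j h1 h2; omega
  intro a ha b hb
  induction ha using Submodule.span_induction with
  | zero => simp
  | add x y _ _ h1 h2 => simp only [map_add, LinearMap.add_apply, h1, h2, add_mul]
  | smul c x _ h => simp only [map_smul, LinearMap.smul_apply, h, smul_mul_assoc]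
  | mem x hx =>
    obtain ⟨s, hs, rfl⟩ := hx
    induction hb using Submodule.span_induction with
    | zero => simp
    | add x y _ _ h1 h2 => simp only [map_add, h1, h2, mul_add]
    | smul c x _ h => simp only [map_smul, h, mul_smul_comm]
    | mem y hy =>
      obtain ⟨t, ht, rfl⟩ := hy
      have hs' := hV s hs
      have ht' := hV t ht
      have hmem : m (bs s) (bs t) ∈ V (-1) :=
        V_mono (by norm_num) (shuffle_V m hm s t (-1) (-1) hs' ht')
      rw [← (hasSum_zeta hmem).tsum_eq, LiM_shuffle m hm, zetaMap_bs, zetaMap_bs, zetaS_eq,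
        zetaS_eq, tsum_mul_tsum_eq_tsum_sum_antidiagonal_of_summable_norm
          (cf_summable s hs').norm (cf_summable t ht').norm]
      refine tsum_congr fun n => ?_
      rw [PowerSeries.coeff_mul]
      simp [LiS]
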